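/- Let W be the Weyl group of a Kac–Moody group, w̲ ∈ Wⁿ, and v ∈ W with v ≤ m_∗(w̲). Then there exists a unique v̲ ∈ Wⁿ such that m_•(v̲) = v and v̲ is positive in w̲; moreover for this v̲ one has m_∗(v̲) = v. -/

import Mathlib

open Pointwise Topology

noncomputable section

namespace TotPos

/-! ### Coxeter combinatorics: Bruhat order (subword property) and Demazure product -/

section Coxeter

variable {B W : Type} [Group W] {M : CoxeterMatrix B}

/-- The Bruhat order on a Coxeter group, via the subword property. -/
def BruhatLE (cs : CoxeterSystem M W) (v w : W) : Prop :=
  ∃ ω : List B, cs.IsReduced ω ∧ cs.wordProd ω = w ∧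
    ∃ ω' : List B, ω'.Sublist ω ∧ cs.wordProd ω' = v

def BruhatLT (cs : CoxeterSystem M W) (v w : W) : Prop :=
  BruhatLE cs v w ∧ v ≠ w

/-- `dem` is the Demazure (star) product of the Coxeter system `cs`:
the associative monoid operation determined by `x ∗ y = x y` when lengths add and
`s ∗ w = w` when `s w < w` for a simple reflection `s`. -/
structure IsDemazure (cs : CoxeterSystem M W) (dem : W → W → W) : Prop where
  assoc : ∀ x y z, dem (dem x y) z = dem x (dem y z)
  eq_mul : ∀ x y, cs.length (x * y) = cs.length x + cs.length y → dem x y = x * y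
  absorb : ∀ (i : B) (w : W), cs.length (cs.simple i * w) < cs.length w →
    dem (cs.simple i) w = w

/-- `m_∗(w_1, …, w_n) = w_1 ∗ w_2 ∗ ⋯ ∗ w_n`. -/
def demProd {n : ℕ} (dem : W → W → W) (w : Fin n → W) : W :=
  (List.ofFn w).foldr dem 1

/-- `m_•(w_1, …, w_n) = w_1 w_2 ⋯ w_n`. -/
def seqProd {n : ℕ} (w : Fin n → W) : W := (List.ofFn w).prod

/-- componentwise Bruhat order on `Wⁿ` -/
def seqLE (cs : CoxeterSystem M W) {n : ℕ} (v w : Fin n → W) : Prop :=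
  ∀ i, BruhatLE cs (v i) (w i)

/-- `v̲` is positive in `w̲`. -/
def IsPositiveSeq (cs : CoxeterSystem M W) {n : ℕ} (v w : Fin n → W) : Prop :=
  seqLE cs v w ∧
  ∀ (i : Fin n) (v' : Fin n → W),
    (∀ j, j < i → BruhatLE cs (v' j) (v j)) →
    BruhatLE cs (v' i) (w i) →
    ((List.ofFn v').take ((i : ℕ) + 1)).prod = ((List.ofFn v).take ((i : ℕ) + 1)).prod →
    ∀ j, j ≤ i → v' j = v j

/-- the product of the first `k` letters of the subexpression `ε` of the word `ω`. -/
def subwordProd (cs : CoxeterSystem M W) (ω : List B) (ε : Fin ω.length → Bool)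
    (k : ℕ) : W :=
  ((List.ofFn fun j => if ε j then cs.simple (ω.get j) else 1).take k).prod

/-- `ε` is a positive subexpression of the reduced word `ω`, with total product `v`
(Marsh–Rietsch). -/
def IsPositiveSubexpr (cs : CoxeterSystem M W) (ω : List B)
    (ε : Fin ω.length → Bool) (v : W) : Prop :=
  subwordProd cs ω ε ω.length = v ∧
  ∀ j : Fin ω.length,
    BruhatLT cs (subwordProd cs ω ε (j : ℕ))
      (subwordProd cs ω ε (j : ℕ) * cs.simple (ω.get j))

end Coxeter

/-! ### Poset combinatorics, relative to a relation -/

section Posets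

variable {α : Type*}

/-- covering relation of the partial order `r` -/
def CovR (r : α → α → Prop) (x y : α) : Prop :=
  r x y ∧ x ≠ y ∧ ∀ z, r x z → r z y → z = x ∨ z = y

/-- `l` is a maximal (saturated) chain from `x` to `y` -/
def IsMaxChainList (r : α → α → Prop) (x y : α) (l : List α) : Prop :=
  l.Chain' (CovR r) ∧ l.head? = some x ∧ l.getLast? = some y

/-- the poset `r` is pure: maximal chains between comparable elements exist and all
have the same length. -/
def PureR (r : α → α → Prop) : Prop :=
  ∀ x y, r x y → (∃ l, IsMaxChainList r x y l) ∧
    ∀ l l', IsMaxChainList r x y l → IsMaxChainList r x y l' → l.length = l'.length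

/-- the poset `r` is thin: every interval of length 2 has exactly four elements. -/
def ThinR (r : α → α → Prop) : Prop :=
  ∀ x y, (∃ z, CovR r x z ∧ CovR r z y) → {z | r x z ∧ r z y}.ncard = 4

/-- `c` is a maximal chain of the subposet `s` of `r`; maximal chains are the maximal
faces of the order complex. -/
def IsMaxChainFinset (r : α → α → Prop) (s : Set α) (c : Finset α) : Prop :=
  ↑c ⊆ s ∧ IsChain r ↑c ∧
    ∀ c' : Finset α, ↑c' ⊆ s → IsChain r ↑c' → c ⊆ c' → c = c'

/-- The (finite) subposet `s` of `r` is shellable: its maximal chains can be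
enumerated `F 0, F 1, …` so that each `F k ∩ (F 0 ∪ ⋯ ∪ F (k-1))` is a nonempty union
of maximal proper faces of the simplex `F k`.  (Faces of the order complex contained
in a chain `F k` are just the subsets of `F k`.) -/
def ShellableR (r : α → α → Prop) (s : Set α) : Prop :=
  ∃ (N : ℕ) (F : Fin N → Finset α), Function.Injective F ∧
    (∀ c, IsMaxChainFinset r s c ↔ ∃ k, F k = c) ∧
    ∀ k : Fin N, 0 < (k : ℕ) →
      ∃ S : Finset α, S.Nonempty ∧ S ⊆ F k ∧
        ∀ c : Finset α, (c ⊆ F k ∧ ∃ i, i < k ∧ c ⊆ F i) ↔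
          ∃ a ∈ S, (c : Set α) ⊆ ↑(F k) \ {a}

end Posets

/-! ### Regular CW complexes -/

section CW

/-- `X = ⊔ strata i` is a regular CW complex: finitely many strata, the closure of each
stratum is the homeomorphic image of a closed ball with the stratum corresponding to the
open ball, and the closure of each stratum is a union of strata. -/
def IsRegularCW {X ι : Type} [TopologicalSpace X] (strata : ι → Set X) : Prop :=
  Finite ι ∧
  (Pairwise fun i j => Disjoint (strata i) (strata j)) ∧
  (∀ i : ι, ∃ (d : ℕ)
    (e : ↥(Metric.closedBall (0 : EuclideanSpace ℝ (Fin d)) 1) ≃ₜ ↥(closure (strata i))),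
    ∀ x, ((e x : X) ∈ strata i ↔ ‖(x : EuclideanSpace ℝ (Fin d))‖ < 1)) ∧
  (∀ i : ι, ∃ s : Set ι, closure (strata i) = ⋃ j ∈ s, strata j)

/-- `X` is homeomorphic to a closed ball of dimension `d`. -/
def HomeoToClosedBall (X : Type) [TopologicalSpace X] (d : ℕ) : Prop :=
  Nonempty (X ≃ₜ ↥(Metric.closedBall (0 : EuclideanSpace ℝ (Fin d)) 1))

end CW

/-! ### The group-theoretic setting: pinned Kac–Moody-type group, flag variety,
twisted products, total positivity -/

section Grp

variable {B W G : Type} [Group W] {M : CoxeterMatrix B} [Group G] [TopologicalSpace G]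

/-- `U⁻_{≥0}` (resp. `U⁺_{≥0}`): the submonoid generated by the `y i (a)` (resp `x i a`)
for real `a > 0`. -/
def Unn (y : B → ℂ → G) : Set G :=
  (Submonoid.closure {g : G | ∃ (i : B) (a : ℝ), 0 < a ∧ g = y i (a : ℂ)} : Set G)

/-- double coset `A g C` -/
def dcos (A C : Subgroup G) (g : G) : Set G := (A : Set G) * {g} * (C : Set G)

/-- the defining relation of the twisted product
`𝓩 = G ×^{B⁺} G ×^{B⁺} ⋯ ×^{B⁺} G/B⁺`. -/
def twistRel (Bp : Subgroup G) (n : ℕ) (g h : Fin n → G) : Prop :=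
  ∃ b : Fin n → G, (∀ i, b i ∈ Bp) ∧
    ∀ i : Fin n, h i = (if (i : ℕ) = 0 then (1 : G)
      else b ⟨(i : ℕ) - 1, lt_of_le_of_lt (Nat.sub_le _ _) i.isLt⟩)⁻¹ * g i * b i

/-- the twisted product `𝓩 = G ×^{B⁺} ⋯ ×^{B⁺} G/B⁺` (`n` factors), as a quotient
topological space. -/
def Zspace (Bp : Subgroup G) (n : ℕ) : Type := Quot (twistRel Bp n)

instance (Bp : Subgroup G) (n : ℕ) : TopologicalSpace (Zspace Bp n) :=
  instTopologicalSpaceQuot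

def mkZ (Bp : Subgroup G) (n : ℕ) (g : Fin n → G) : Zspace Bp n := Quot.mk _ g

/-- the Schubert cell `𝓩̊_{w̲} = B⁺ẇ_1B⁺ ×^{B⁺} ⋯ ×^{B⁺} B⁺ẇ_nB⁺/B⁺` -/
def schubertZ (Bp : Subgroup G) (dot : W → G) {n : ℕ} (w : Fin n → W) :
    Set (Zspace Bp n) :=
  {z | ∃ g : Fin n → G, z = mkZ Bp n g ∧ ∀ i, g i ∈ dcos Bp Bp (dot (w i))}

/-- the opposite Schubert cell `𝓩̊ᵛ = m⁻¹(B⁻v̇B⁺/B⁺)`, `m` the convolution product -/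
def oppSchubertZ (Bp Bm : Subgroup G) (dot : W → G) {n : ℕ} (v : W) :
    Set (Zspace Bp n) :=
  {z | ∃ g : Fin n → G, z = mkZ Bp n g ∧ (List.ofFn g).prod ∈ dcos Bm Bp (dot v)}

/-- the open Richardson variety `𝓩̊_{v,w̲} = 𝓩̊_{w̲} ∩ 𝓩̊ᵛ` -/
def openRichZ (Bp Bm : Subgroup G) (dot : W → G) {n : ℕ} (v : W) (w : Fin n → W) :
    Set (Zspace Bp n) :=
  schubertZ Bp dot w ∩ oppSchubertZ Bp Bm dot v

/-- the totally nonnegative part `𝓩_{≥0}`: the Hausdorff closure of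
`(U⁻_{≥0}, …, U⁻_{≥0}B⁺/B⁺)`. -/
def Znn (Bp : Subgroup G) (y : B → ℂ → G) (n : ℕ) : Set (Zspace Bp n) :=
  closure (mkZ Bp n '' {g | ∀ i, g i ∈ Unn y})

/-- the totally positive stratum `𝓩_{v,w̲,>0} = 𝓩_{≥0} ∩ 𝓩̊_{v,w̲}` -/
def posZ (Bp Bm : Subgroup G) (y : B → ℂ → G) (dot : W → G) {n : ℕ}
    (v : W) (w : Fin n → W) : Set (Zspace Bp n) :=
  Znn Bp y n ∩ openRichZ Bp Bm dot v w

/-- the Marsh–Rietsch set `G_{𝐯₊,𝐰,>0}` attached to a reduced word `ω` and a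
(positive) subexpression `ε`. -/
def MRCell (cs : CoxeterSystem M W) (y : B → ℂ → G) (dot : W → G)
    (ω : List B) (ε : Fin ω.length → Bool) : Set G :=
  {g | ∃ c : Fin ω.length → ℝ, (∀ j, 0 < c j) ∧
    g = (List.ofFn fun j =>
      if ε j then dot (cs.simple (ω.get j)) else y (ω.get j) ((c j : ℝ) : ℂ)).prod}

end Grp


/-! ### Flag varieties, double Bruhat cells, duality -/

section Flag

variable {B W G : Type} [Group W] {M : CoxeterMatrix B} [Group G] [TopologicalSpace G]

def flagMk (Bp : Subgroup G) (g : G) : G ⧸ Bp := QuotientGroup.mk g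

/-- the Schubert cell `𝓑̊_w = B⁺ẇB⁺/B⁺` -/
def schubertF (Bp : Subgroup G) (dot : W → G) (w : W) : Set (G ⧸ Bp) :=
  flagMk Bp '' dcos Bp Bp (dot w)

/-- the opposite Schubert cell `𝓑̊ᵛ = B⁻v̇B⁺/B⁺` -/
def oppSchubertF (Bp Bm : Subgroup G) (dot : W → G) (v : W) : Set (G ⧸ Bp) :=
  flagMk Bp '' dcos Bm Bp (dot v)

/-- the open Richardson variety `𝓑̊_{v,w} = 𝓑̊_w ∩ 𝓑̊ᵛ` -/
def richF (Bp Bm : Subgroup G) (dot : W → G) (v w : W) : Set (G ⧸ Bp) :=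
  schubertF Bp dot w ∩ oppSchubertF Bp Bm dot v

/-- the totally nonnegative flag variety `𝓑_{≥0}`, the Hausdorff closure of
`U⁻_{≥0} B⁺/B⁺` -/
def flagNN (Bp : Subgroup G) (y : B → ℂ → G) : Set (G ⧸ Bp) :=
  closure (flagMk Bp '' Unn y)

/-- the totally positive Richardson stratum `𝓑_{v,w,>0} = 𝓑_{≥0} ∩ 𝓑̊_{v,w}` -/
def posF (Bp Bm : Subgroup G) (y : B → ℂ → G) (dot : W → G) (v w : W) :
    Set (G ⧸ Bp) :=
  flagNN Bp y ∩ richF Bp Bm dot v w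

/-- the totally nonnegative monoid `G_{≥0}`, generated by `U⁺_{≥0}`, `U⁻_{≥0}` and
`T_{>0}` -/
def Gnn (x y : B → ℂ → G) (Tpos : Set G) : Set G :=
  (Submonoid.closure ({g : G | ∃ (i : B) (a : ℝ), 0 < a ∧ g = x i (a : ℂ)} ∪
    {g : G | ∃ (i : B) (a : ℝ), 0 < a ∧ g = y i (a : ℂ)} ∪ Tpos) : Set G)

/-- the double Bruhat cell `G^{v,w} = B⁺ẇB⁺ ∩ B⁻v̇B⁻` -/
def dBruhatCell (Bp Bm : Subgroup G) (dot : W → G) (v w : W) : Set G :=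
  dcos Bp Bp (dot w) ∩ dcos Bm Bm (dot v)

/-- the image of a subset of `𝓩` under the duality map
`Φ(g_1, …, g_n) = (ι(ẇ_0⁻¹g_1⋯g_n), ι(g_n⁻¹), …, ι(g_2⁻¹))`. -/
def PhiSet (Bp : Subgroup G) (ι : G →* G) (dot : W → G) (w0 : W) (n : ℕ)
    (S : Set (Zspace Bp n)) : Set (Zspace Bp n) :=
  {z | ∃ g : Fin n → G, mkZ Bp n g ∈ S ∧
    z = mkZ Bp n (fun j => if h : (j : ℕ) = 0
      then ι ((dot w0)⁻¹ * (List.ofFn g).prod)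
      else ι (g ⟨n - (j : ℕ), Nat.sub_lt j.pos (Nat.pos_of_ne_zero h)⟩)⁻¹)}

end Flag

/-! ### Parity of inversions and the strong exchange property -/

section StrongExchange

variable {B W : Type} [Group W] {M : CoxeterMatrix B} (cs : CoxeterSystem M W)

open scoped Classical in
/-- The action of a simple reflection on pairs (element, sign), which conjugates the element and
flips the sign exactly at the simple reflection itself. -/
def signedConj (i : B) : Function.End (W × ZMod 2) := fun p =>
  (cs.simple i * p.1 * cs.simple i, p.2 + if p.1 = cs.simple i then 1 else 0)

theorem end_mul_apply {α : Type} (f g : Function.End α) (x : α) : (f * g) x = f (g x) := rfl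

open scoped Classical in
theorem signedConj_mul_pow_apply (i j : B) (k : ℕ) (x : W) (e : ZMod 2) :
    ((signedConj cs i * signedConj cs j) ^ k : Function.End (W × ZMod 2)) (x, e) =
      ((cs.simple i * cs.simple j) ^ k * x * (cs.simple j * cs.simple i) ^ k,
        e + ∑ l ∈ Finset.range (2 * k),
          if x = (cs.simple j * cs.simple i) ^ l * cs.simple j then 1 else 0) := by
  induction k generalizing x e with
  | zero => simp [Function.End.one_def]
  | succ k ih =>
    have h1 : cs.simple j * x * cs.simple j = cs.simple i ↔
        x = (cs.simple j * cs.simple i) ^ (0 + 1) * cs.simple j := by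
      constructor
      · intro h
        rw [zero_add, pow_one, ← h]
        simp [mul_assoc]
      · rintro rfl
        simp [mul_assoc]
    have h2 (l : ℕ) : cs.simple i * (cs.simple j * x * cs.simple j) * cs.simple i =
        (cs.simple j * cs.simple i) ^ l * cs.simple j ↔
        x = (cs.simple j * cs.simple i) ^ (l + 1 + 1) * cs.simple j := by
      have hc : (cs.simple j * cs.simple i) ^ (l + 1 + 1) * cs.simple j =
          cs.simple j * cs.simple i * ((cs.simple j * cs.simple i) ^ l * cs.simple j) *
            (cs.simple i * cs.simple j) := by
        rw [pow_succ, pow_succ']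
        simp [mul_assoc]
      rw [hc]
      constructor
      · intro h
        rw [← h]
        simp [mul_assoc]
      · intro h
        rw [h]
        simp [mul_assoc]
    rw [pow_succ, end_mul_apply, end_mul_apply]
    simp only [signedConj]
    rw [ih, show 2 * (k + 1) = 2 * k + 1 + 1 by ring, Finset.sum_range_succ',
      Finset.sum_range_succ']
    simp only [h1, h2, pow_zero, one_mul]
    refine Prod.ext ?_ ?_
    · rw [pow_succ (cs.simple i * cs.simple j) k, pow_succ' (cs.simple j * cs.simple i) k]
      simp only [mul_assoc]
    · simp only
      ring

theorem signedConj_isLiftable : M.IsLiftable (signedConj cs) := by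
  classical
  intro i j
  funext p
  obtain ⟨x, e⟩ := p
  have hji : (cs.simple j * cs.simple i) ^ M i j = 1 := by
    rw [M.symmetric i j]
    exact cs.simple_mul_simple_pow j i
  rw [signedConj_mul_pow_apply, two_mul, Finset.sum_range_add]
  simp only [pow_add, hji, cs.simple_mul_simple_pow, one_mul, mul_one]
  rw [CharTwo.add_self_eq_zero, add_zero]
  rfl

/-- The parity of the multiplicity of `x` in the right inversion sequence of a word for `w`. -/
def invParity (w x : W) : ZMod 2 :=
  (cs.lift ⟨signedConj cs, signedConj_isLiftable cs⟩ w (x, 0)).2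

theorem lift_signedConj_wordProd (ω : List B) (x : W) (e : ZMod 2) :
    cs.lift ⟨signedConj cs, signedConj_isLiftable cs⟩ (cs.wordProd ω) (x, e) =
      (cs.wordProd ω * x * (cs.wordProd ω)⁻¹,
        e + invParity cs (cs.wordProd ω) x) := by
  induction ω generalizing x e with
  | nil => simp [invParity, Function.End.one_def]
  | cons i ω ih =>
    have h := ih x 0
    have h' := ih x e
    simp only [invParity, cs.wordProd_cons, map_mul, end_mul_apply,
      cs.lift_apply_simple] at h h' ⊢
    rw [h, h']
    simp [signedConj, mul_assoc, add_assoc]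

theorem invParity_one (x : W) : invParity cs 1 x = 0 := by
  simp [invParity, Function.End.one_def]

open scoped Classical in
theorem invParity_simple (i : B) (x : W) :
    invParity cs (cs.simple i) x = if x = cs.simple i then 1 else 0 := by
  simp [invParity, signedConj]

theorem invParity_mul (u v x : W) :
    invParity cs (u * v) x = invParity cs v x + invParity cs u (v * x * v⁻¹) := by
  obtain ⟨α, rfl⟩ := cs.wordProd_surjective u
  obtain ⟨β, rfl⟩ := cs.wordProd_surjective v
  rw [invParity, map_mul, end_mul_apply, lift_signedConj_wordProd,
    lift_signedConj_wordProd, zero_add]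

theorem mem_rightInvSeq_of_invParity_ne_zero {ω : List B} {x : W}
    (h : invParity cs (cs.wordProd ω) x ≠ 0) : x ∈ cs.rightInvSeq ω := by
  induction ω with
  | nil => simp [invParity_one] at h
  | cons i ω ih =>
    rw [cs.wordProd_cons, invParity_mul, invParity_simple] at h
    rw [CoxeterSystem.rightInvSeq, List.mem_cons]
    by_cases hx : cs.wordProd ω * x * (cs.wordProd ω)⁻¹ = cs.simple i
    · left
      rw [← hx]
      group
    · right
      rw [if_neg hx, add_zero] at h
      exact ih h

theorem invParity_self {t : W} (ht : cs.IsReflection t) : invParity cs t t = 1 := by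
  obtain ⟨u, i, rfl⟩ := ht
  have h := invParity_one cs (u * cs.simple i * u⁻¹)
  rw [← mul_inv_cancel u, invParity_mul] at h
  have h0 : u⁻¹ * (u * cs.simple i * u⁻¹) * u⁻¹⁻¹ = cs.simple i := by group
  rw [invParity_mul _ (u * cs.simple i) u⁻¹, invParity_mul _ u]
  rw [h0] at h ⊢
  rw [invParity_simple, if_pos rfl, mul_inv_cancel_right, add_left_comm, h, add_zero]

theorem invParity_ne_zero_iff {w t : W} (ht : cs.IsReflection t) :
    invParity cs w t ≠ 0 ↔ cs.length (w * t) < cs.length w := by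
  have key : ∀ {u : W}, invParity cs u t ≠ 0 → cs.length (u * t) < cs.length u := by
    intro u hu
    obtain ⟨ω, hω, rfl⟩ := cs.exists_isReduced u
    exact (cs.isRightInversion_of_mem_rightInvSeq hω
      (mem_rightInvSeq_of_invParity_ne_zero cs hu)).2
  refine ⟨key, fun h h0 => ?_⟩
  have h1 : invParity cs (w * t) t ≠ 0 := by
    rw [invParity_mul, invParity_self cs ht, mul_inv_cancel_right, h0]
    decide
  have h2 := key h1
  rw [mul_assoc, ht.mul_self, mul_one] at h2
  omega

/-- The strong exchange property: right multiplication by a right inversion deletes a letter. -/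
theorem exists_sublist_of_isRightInversion {ω : List B} {t : W}
    (h : cs.IsRightInversion (cs.wordProd ω) t) :
    ∃ ω' : List B, ω'.Sublist ω ∧ cs.wordProd ω' = cs.wordProd ω * t := by
  have hm := mem_rightInvSeq_of_invParity_ne_zero cs ((invParity_ne_zero_iff cs h.1).2 h.2)
  obtain ⟨j, hj, rfl⟩ := List.mem_iff_getElem.mp hm
  refine ⟨ω.eraseIdx j, List.eraseIdx_sublist _ _, ?_⟩
  rw [← List.getD_eq_getElem _ 1 hj, cs.wordProd_mul_getD_rightInvSeq]

end StrongExchange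

/-! ### The Bruhat order -/

section Bruhat

variable {B W : Type} [Group W] {M : CoxeterMatrix B} (cs : CoxeterSystem M W)

/-- `w` is obtained from `v` by right multiplication by a reflection which increases the length. -/
def BruhatStep (v w : W) : Prop :=
  ∃ t, cs.IsReflection t ∧ w = v * t ∧ cs.length v < cs.length w

theorem BruhatStep.mul_simple {v w : W} (h : BruhatStep cs v w) (i : B) :
    v * cs.simple i = w ∨ BruhatStep cs (v * cs.simple i) (w * cs.simple i) := by
  obtain ⟨t, ht, rfl, hl⟩ := h
  by_cases hti : t = cs.simple i
  · exact Or.inl (by rw [hti])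
  right
  have hr : cs.IsReflection (cs.simple i * t * cs.simple i) := by
    simpa using ht.conj (cs.simple i)
  have hw : v * t * cs.simple i = v * cs.simple i * (cs.simple i * t * cs.simple i) := by
    simp [mul_assoc]
  refine ⟨_, hr, hw, ?_⟩
  have h0 : invParity cs v t = 0 := by
    by_contra h
    have := (invParity_ne_zero_iff cs ht).1 h
    omega
  have hne : ¬ cs.simple i * t * cs.simple i = cs.simple i := by
    intro h
    apply hti
    have := congrArg (fun x => cs.simple i * x * cs.simple i) h
    simpa [mul_assoc] using this
  have h1 : invParity cs (v * cs.simple i) (cs.simple i * t * cs.simple i) = 0 := by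
    rw [invParity_mul, invParity_simple, if_neg hne]
    simpa [mul_assoc] using h0
  have h2 := mt (invParity_ne_zero_iff cs (w := v * cs.simple i) hr).2 (by simpa using h1)
  have h3 := hr.length_mul_left_ne (v * cs.simple i)
  rw [hw]
  omega

theorem exists_sublist_of_reflTransGen {v w : W} (h : Relation.ReflTransGen (BruhatStep cs) v w)
    {ω : List B} (hω : cs.wordProd ω = w) :
    ∃ ω' : List B, ω'.Sublist ω ∧ cs.wordProd ω' = v := by
  induction h generalizing ω with
  | refl => exact ⟨ω, List.Sublist.refl _, hω⟩
  | tail _ hs ih =>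
    obtain ⟨t, ht, rfl, hl⟩ := hs
    have hr : cs.IsRightInversion (cs.wordProd ω) t := by
      refine ⟨ht, ?_⟩
      rwa [hω, mul_assoc, ht.mul_self, mul_one]
    obtain ⟨ω₁, h₁, e₁⟩ := exists_sublist_of_isRightInversion cs hr
    rw [hω, mul_assoc, ht.mul_self, mul_one] at e₁
    obtain ⟨ω₂, h₂, e₂⟩ := ih e₁
    exact ⟨ω₂, h₂.trans h₁, e₂⟩

theorem reflTransGen_mul_simple {v w : W} (h : Relation.ReflTransGen (BruhatStep cs) v w)
    (i : B) : Relation.ReflTransGen (BruhatStep cs) (v * cs.simple i) w ∨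
      Relation.ReflTransGen (BruhatStep cs) (v * cs.simple i) (w * cs.simple i) := by
  induction h with
  | refl => exact Or.inr .refl
  | tail _ hs ih =>
    rcases ih with ih | ih
    · exact Or.inl (ih.tail hs)
    · rcases hs.mul_simple cs i with he | hs'
      · exact Or.inl (he ▸ ih)
      · exact Or.inr (ih.tail hs')

theorem bruhatStep_mul_simple {w : W} {i : B} (h : cs.length w < cs.length (w * cs.simple i)) :
    BruhatStep cs w (w * cs.simple i) :=
  ⟨_, cs.isReflection_simple i, rfl, h⟩

theorem reflTransGen_of_sublist {ω ω' : List B} (hω : cs.IsReduced ω) (h : ω'.Sublist ω) :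
    Relation.ReflTransGen (BruhatStep cs) (cs.wordProd ω') (cs.wordProd ω) := by
  induction ω using List.reverseRecOn generalizing ω' with
  | nil => rw [List.sublist_nil.1 h]
  | append_singleton ω i ih =>
    have hr : cs.IsReduced ω := by simpa using hω.take ω.length
    have hw : cs.wordProd (ω ++ [i]) = cs.wordProd ω * cs.simple i := by
      simp [cs.wordProd_append]
    have hs : BruhatStep cs (cs.wordProd ω) (cs.wordProd ω * cs.simple i) := by
      apply bruhatStep_mul_simple
      rw [← hw, hω.eq, hr.eq]
      simp
    rw [hw]
    obtain ⟨l₁, l₂, rfl, h₁, h₂⟩ := List.sublist_append_iff.1 h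
    rcases List.sublist_singleton.1 h₂ with rfl | rfl
    · simpa using (ih hr h₁).tail hs
    · rw [cs.wordProd_append, cs.wordProd_singleton]
      rcases reflTransGen_mul_simple cs (ih hr h₁) i with h | h
      · exact h.tail hs
      · exact h

theorem bruhatLE_iff_reflTransGen {v w : W} :
    BruhatLE cs v w ↔ Relation.ReflTransGen (BruhatStep cs) v w := by
  constructor
  · rintro ⟨ω, hω, rfl, ω', h, rfl⟩
    exact reflTransGen_of_sublist cs hω h
  · intro h
    obtain ⟨ω, hω, rfl⟩ := cs.exists_isReduced w
    exact ⟨ω, hω, rfl, exists_sublist_of_reflTransGen cs h rfl⟩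

variable {cs}

theorem BruhatLE.exists_sublist {v : W} {ω : List B} (h : BruhatLE cs v (cs.wordProd ω)) :
    ∃ ω' : List B, ω'.Sublist ω ∧ cs.wordProd ω' = v :=
  exists_sublist_of_reflTransGen cs ((bruhatLE_iff_reflTransGen cs).1 h) rfl

theorem BruhatLE.refl (w : W) : BruhatLE cs w w :=
  (bruhatLE_iff_reflTransGen cs).2 .refl

theorem BruhatLE.trans {u v w : W} (h : BruhatLE cs u v) (h' : BruhatLE cs v w) :
    BruhatLE cs u w := by
  rw [bruhatLE_iff_reflTransGen] at *
  exact Relation.ReflTransGen.trans h h'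

theorem BruhatLE.eq_or_length_lt {v w : W} (h : BruhatLE cs v w) :
    v = w ∨ cs.length v < cs.length w := by
  rw [bruhatLE_iff_reflTransGen] at h
  induction h with
  | refl => exact Or.inl rfl
  | tail _ hs ih =>
    obtain ⟨_, _, _, hl⟩ := hs
    right
    rcases ih with rfl | ih
    · exact hl
    · exact ih.trans hl

theorem BruhatLE.antisymm {v w : W} (h : BruhatLE cs v w) (h' : BruhatLE cs w v) : v = w := by
  rcases h.eq_or_length_lt with h | h
  · exact h
  · rcases h'.eq_or_length_lt with h' | h'
    · exact h'.symm
    · omega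

theorem BruhatLE.mul_simple {v w : W} (h : BruhatLE cs v w) (i : B) :
    BruhatLE cs (v * cs.simple i) w ∨ BruhatLE cs (v * cs.simple i) (w * cs.simple i) := by
  simp only [bruhatLE_iff_reflTransGen] at *
  exact reflTransGen_mul_simple cs h i

theorem bruhatLE_mul_simple {w : W} {i : B} (h : cs.length w < cs.length (w * cs.simple i)) :
    BruhatLE cs w (w * cs.simple i) :=
  (bruhatLE_iff_reflTransGen cs).2 (.single (bruhatStep_mul_simple cs h))

theorem mul_simple_bruhatLE {w : W} {i : B} (h : cs.length (w * cs.simple i) < cs.length w) :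
    BruhatLE cs (w * cs.simple i) w := by
  have h' := bruhatLE_mul_simple (cs := cs) (w := w * cs.simple i) (i := i)
  rw [cs.simple_mul_simple_cancel_right] at h'
  exact h' h

/-- Lifting property. -/
theorem BruhatLE.of_mul_simple {v w : W} {i : B}
    (hw : cs.length w < cs.length (w * cs.simple i)) (h : BruhatLE cs v (w * cs.simple i)) :
    BruhatLE cs v w ∨ BruhatLE cs (v * cs.simple i) w := by
  obtain ⟨ω, hω, rfl⟩ := cs.exists_isReduced w
  rw [← cs.wordProd_singleton i, ← cs.wordProd_append] at h
  obtain ⟨ω', hs, rfl⟩ := h.exists_sublist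
  obtain ⟨l₁, l₂, rfl, h₁, h₂⟩ := List.sublist_append_iff.1 hs
  rcases List.sublist_singleton.1 h₂ with rfl | rfl
  · exact Or.inl ⟨ω, hω, rfl, l₁, h₁, by simp⟩
  · exact Or.inr ⟨ω, hω, rfl, l₁, h₁, by simp [cs.wordProd_append]⟩

/-- Among the left factors of `v` whose complementary right factor is a subword product of `ω`,
there is a smallest one, and the corresponding factorization is length additive. -/
theorem exists_min_left_factor_word (ω : List B) (v : W) :
    ∃ (m : W) (α : List B), α.Sublist ω ∧ m * cs.wordProd α = v ∧
      cs.length v = cs.length m + cs.length (cs.wordProd α) ∧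
      ∀ (a : W) (β : List B), β.Sublist ω → a * cs.wordProd β = v → BruhatLE cs m a := by
  induction ω with
  | nil =>
    refine ⟨v, [], List.Sublist.refl _, by simp, by simp, ?_⟩
    intro a β hβ h
    rw [List.sublist_nil.1 hβ, cs.wordProd_nil, mul_one] at h
    rw [h]
    exact .refl v
  | cons i ω ih =>
    obtain ⟨m, α, hα, hm, hl, hmin⟩ := ih
    have main : ∀ m', BruhatLE cs m' m → BruhatLE cs m' (m * cs.simple i) →
        ∀ (a : W) (β : List B), β.Sublist (i :: ω) → a * cs.wordProd β = v →
          BruhatLE cs m' a := by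
      intro m' h₁ h₂ a β hβ h
      rcases List.sublist_cons_iff.1 hβ with hβ | ⟨γ, rfl, hγ⟩
      · exact h₁.trans (hmin a β hβ h)
      rw [cs.wordProd_cons, ← mul_assoc] at h
      have h₃ := hmin _ γ hγ h
      rcases lt_or_gt_of_ne (cs.length_mul_simple_ne a i) with hlt | hgt
      · exact h₁.trans (h₃.trans (mul_simple_bruhatLE hlt))
      · rcases h₃.of_mul_simple hgt with h₃ | h₃
        · exact h₁.trans h₃
        · exact h₂.trans h₃
    rcases lt_or_gt_of_ne (cs.length_mul_simple_ne m i) with hlt | hgt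
    · refine ⟨m * cs.simple i, i :: α, hα.cons_cons i, ?_, ?_, main _ ?_ (.refl _)⟩
      · rw [cs.wordProd_cons]
        simpa [mul_assoc] using hm
      · have h₁ := cs.length_mul_le (m * cs.simple i) (cs.wordProd (i :: α))
        have h₂ := cs.length_mul_le (cs.simple i) (cs.wordProd α)
        have h₃ : m * cs.simple i * cs.wordProd (i :: α) = v := by
          rw [cs.wordProd_cons]
          simpa [mul_assoc] using hm
        rw [h₃] at h₁
        rw [cs.length_simple, ← cs.wordProd_cons] at h₂
        omega
      · exact mul_simple_bruhatLE hlt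
    · exact ⟨m, α, hα.cons i, hm, hl, main _ (.refl _) (bruhatLE_mul_simple hgt)⟩

theorem exists_min_left_factor (v y : W) :
    ∃ m b : W, BruhatLE cs b y ∧ m * b = v ∧ cs.length v = cs.length m + cs.length b ∧
      ∀ a c : W, BruhatLE cs c y → a * c = v → BruhatLE cs m a := by
  obtain ⟨ω, hω, rfl⟩ := cs.exists_isReduced y
  obtain ⟨m, α, hα, hm, hl, hmin⟩ := exists_min_left_factor_word (cs := cs) ω v
  refine ⟨m, cs.wordProd α, ⟨ω, hω, rfl, α, hα, rfl⟩, hm, hl, ?_⟩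
  intro a c hc h
  obtain ⟨β, hβ, rfl⟩ := hc.exists_sublist
  exact hmin a β hβ h

end Bruhat

/-! ### Demazure products and positive sequences -/

section Demazure

variable {B W : Type} [Group W] {M : CoxeterMatrix B} {cs : CoxeterSystem M W} {dem : W → W → W}

theorem IsDemazure.mul_simple_of_lt (hdem : IsDemazure cs dem) {x : W} {i : B}
    (h : cs.length x < cs.length (x * cs.simple i)) :
    dem x (cs.simple i) = x * cs.simple i := by
  apply hdem.eq_mul
  have := cs.length_mul_simple x i
  rw [cs.length_simple]
  omega

theorem IsDemazure.mul_simple_of_gt (hdem : IsDemazure cs dem) {x : W} {i : B}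
    (h : cs.length (x * cs.simple i) < cs.length x) : dem x (cs.simple i) = x := by
  have h₁ : dem (x * cs.simple i) (cs.simple i) = x := by
    have h' := hdem.mul_simple_of_lt (x := x * cs.simple i) (i := i)
    rw [cs.simple_mul_simple_cancel_right] at h'
    exact h' h
  have h₂ : dem (cs.simple i) (cs.simple i) = cs.simple i := hdem.absorb _ _ (by simp)
  conv_lhs => rw [← h₁, hdem.assoc, h₂]
  exact h₁

theorem IsDemazure.one_right (hdem : IsDemazure cs dem) (x : W) : dem x 1 = x := by
  simpa using hdem.eq_mul x 1 (by simp)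

theorem IsDemazure.one_left (hdem : IsDemazure cs dem) (x : W) : dem 1 x = x := by
  simpa using hdem.eq_mul 1 x (by simp)

theorem IsDemazure.bruhatLE_dem_simple_iff (hdem : IsDemazure cs dem) {v x : W} {i : B} :
    BruhatLE cs v (dem x (cs.simple i)) ↔
      BruhatLE cs v x ∨ BruhatLE cs (v * cs.simple i) x := by
  rcases lt_or_gt_of_ne (cs.length_mul_simple_ne x i) with hlt | hgt
  · rw [hdem.mul_simple_of_gt hlt]
    refine ⟨Or.inl, fun h => h.elim id fun h => ?_⟩
    rcases h.mul_simple i with h | h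
    · simpa using h
    · rw [cs.simple_mul_simple_cancel_right] at h
      exact h.trans (mul_simple_bruhatLE hlt)
  · rw [hdem.mul_simple_of_lt hgt]
    refine ⟨BruhatLE.of_mul_simple hgt, fun h => h.elim
      (fun h => h.trans (bruhatLE_mul_simple hgt)) fun h => ?_⟩
    rcases h.mul_simple i with h | h
    · rw [cs.simple_mul_simple_cancel_right] at h
      exact h.trans (bruhatLE_mul_simple hgt)
    · rwa [cs.simple_mul_simple_cancel_right] at h

/-- The lower interval of a Demazure product is the product of the lower intervals. -/
theorem IsDemazure.bruhatLE_dem_iff (hdem : IsDemazure cs dem) {v x y : W} :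
    BruhatLE cs v (dem x y) ↔ ∃ a b, BruhatLE cs a x ∧ BruhatLE cs b y ∧ a * b = v := by
  obtain ⟨ω, hω, rfl⟩ := cs.exists_isReduced y
  induction ω using List.reverseRecOn generalizing v with
  | nil =>
    rw [cs.wordProd_nil, hdem.one_right]
    constructor
    · exact fun h => ⟨v, 1, h, .refl _, mul_one v⟩
    · rintro ⟨a, b, ha, hb, rfl⟩
      rw [← cs.wordProd_nil] at hb
      obtain ⟨β, hβ, rfl⟩ := hb.exists_sublist
      rw [List.sublist_nil.1 hβ]
      simpa using ha
  | append_singleton ω i ih =>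
    have hr : cs.IsReduced ω := by simpa using hω.take ω.length
    have hw : cs.wordProd (ω ++ [i]) = cs.wordProd ω * cs.simple i := by
      simp [cs.wordProd_append]
    have hlt : cs.length (cs.wordProd ω) < cs.length (cs.wordProd ω * cs.simple i) := by
      rw [← hw, hω.eq, hr.eq]
      simp
    have hd := hdem.mul_simple_of_lt hlt
    rw [hw, ← hd, ← hdem.assoc, hdem.bruhatLE_dem_simple_iff, ih hr, ih hr]
    simp only [hdem.bruhatLE_dem_simple_iff]
    constructor
    · rintro (⟨a, b, ha, hb, rfl⟩ | ⟨a, b, ha, hb, h⟩)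
      · exact ⟨a, b, ha, Or.inl hb, rfl⟩
      · refine ⟨a, b * cs.simple i, ha, Or.inr (by simpa using hb), ?_⟩
        rw [← mul_assoc, h, cs.simple_mul_simple_cancel_right]
    · rintro ⟨a, b, ha, hb | hb, rfl⟩
      · exact Or.inl ⟨a, b, ha, hb, rfl⟩
      · exact Or.inr ⟨a, b * cs.simple i, ha, hb, by rw [mul_assoc]⟩

theorem IsDemazure.foldr_concat (hdem : IsDemazure cs dem) (l : List W) (x : W) :
    (l ++ [x]).foldr dem 1 = dem (l.foldr dem 1) x := by
  induction l with
  | nil => simp [hdem.one_right, hdem.one_left]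
  | cons a l ih => simp only [List.cons_append, List.foldr_cons, ih, hdem.assoc]

theorem ofFn_snoc {α : Type} {n : ℕ} (v : Fin n → α) (x : α) :
    List.ofFn (Fin.snoc v x : Fin (n + 1) → α) = List.ofFn v ++ [x] := by
  rw [List.ofFn_succ', List.concat_eq_append]
  simp

theorem IsDemazure.demProd_snoc (hdem : IsDemazure cs dem) {n : ℕ} (v : Fin n → W) (x : W) :
    demProd dem (Fin.snoc v x : Fin (n + 1) → W) = dem (demProd dem v) x := by
  rw [demProd, ofFn_snoc, hdem.foldr_concat, demProd]

theorem seqProd_snoc {n : ℕ} (v : Fin n → W) (x : W) :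
    seqProd (Fin.snoc v x : Fin (n + 1) → W) = seqProd v * x := by
  rw [seqProd, ofFn_snoc, List.prod_append, List.prod_singleton, seqProd]

theorem seqLE_snoc_iff {n : ℕ} {v w : Fin n → W} {x y : W} :
    seqLE cs (Fin.snoc v x : Fin (n + 1) → W) (Fin.snoc w y : Fin (n + 1) → W) ↔
      seqLE cs v w ∧ BruhatLE cs x y := by
  simp [seqLE, Fin.forall_fin_succ']

theorem IsDemazure.bruhatLE_demProd_iff (hdem : IsDemazure cs dem) {n : ℕ} {v : Fin n → W}
    {x : W} : BruhatLE cs x (demProd dem v) ↔ ∃ u : Fin n → W, seqLE cs u v ∧ seqProd u = x := by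
  induction n generalizing x with
  | zero =>
    constructor
    · intro h
      rw [demProd, List.ofFn_zero, List.foldr_nil, ← cs.wordProd_nil] at h
      obtain ⟨β, hβ, rfl⟩ := h.exists_sublist
      exact ⟨v, fun i => i.elim0, by simp [seqProd, List.sublist_nil.1 hβ]⟩
    · rintro ⟨u, -, rfl⟩
      simpa [seqProd, demProd] using BruhatLE.refl (cs := cs) 1
  | succ n ih =>
    induction v using Fin.snocCases with
    | snoc v y =>
    rw [hdem.demProd_snoc, hdem.bruhatLE_dem_iff]
    constructor
    · rintro ⟨a, b, ha, hb, rfl⟩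
      obtain ⟨u, hu, rfl⟩ := ih.1 ha
      exact ⟨Fin.snoc u b, seqLE_snoc_iff.2 ⟨hu, hb⟩, seqProd_snoc u b⟩
    · rintro ⟨u, hu, rfl⟩
      induction u using Fin.snocCases with
      | snoc u b =>
      rw [seqLE_snoc_iff] at hu
      exact ⟨seqProd u, b, ih.2 ⟨u, hu.1, rfl⟩, hu.2, (seqProd_snoc u b).symm⟩

theorem isPositiveSeq_snoc_iff {n : ℕ} {v w : Fin n → W} {x y : W} :
    IsPositiveSeq cs (Fin.snoc v x : Fin (n + 1) → W) (Fin.snoc w y : Fin (n + 1) → W) ↔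
      IsPositiveSeq cs v w ∧ BruhatLE cs x y ∧
        ∀ (u : Fin n → W) (z : W), seqLE cs u v → BruhatLE cs z y →
          seqProd u * z = seqProd v * x → u = v ∧ z = x := by
  have take_snoc (i : Fin n) (u : Fin n → W) (z : W) :
      (List.ofFn (Fin.snoc u z : Fin (n + 1) → W)).take ((i : ℕ) + 1) =
        (List.ofFn u).take ((i : ℕ) + 1) := by
    rw [ofFn_snoc, List.take_append_of_le_length (by simp)]
  have take_last (u : Fin n → W) (z : W) :
      ((List.ofFn (Fin.snoc u z : Fin (n + 1) → W)).take (n + 1)).prod = seqProd u * z := by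
    rw [List.take_of_length_le (by simp), ← seqProd_snoc, seqProd]
  constructor
  · rintro ⟨hle, h⟩
    rw [seqLE_snoc_iff] at hle
    refine ⟨⟨hle.1, fun i u hu hi hp j hj => ?_⟩, hle.2, fun u z hu hz hp => ?_⟩
    · have := h i.castSucc (Fin.snoc u x) (fun k hk => ?_) (by simpa using hi)
        (by simpa only [Fin.val_castSucc, take_snoc] using hp) j.castSucc (by simpa using hj)
      · simpa using this
      · induction k using Fin.lastCases with
        | last => simpa using BruhatLE.refl (cs := cs) x
        | cast k => simpa using hu k (by simpa using hk)
    · have := h (Fin.last n) (Fin.snoc u z) (fun k hk => ?_) (by simpa using hz)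
        (by simpa only [Fin.val_last, take_last] using hp)
      · refine ⟨funext fun j => ?_, ?_⟩
        · simpa using this j.castSucc (Fin.le_last _)
        · simpa using this (Fin.last n) le_rfl
      · induction k using Fin.lastCases with
        | last => exact absurd hk (lt_irrefl _)
        | cast k => simpa using hu k
  · rintro ⟨⟨hle, h⟩, hx, hlast⟩
    refine ⟨seqLE_snoc_iff.2 ⟨hle, hx⟩, fun i u hu hi hp => ?_⟩
    induction u using Fin.snocCases with
    | snoc u z =>
    induction i using Fin.lastCases with
    | last =>
      obtain ⟨rfl, rfl⟩ := hlast u z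
        (fun j => by simpa using hu j.castSucc (Fin.castSucc_lt_last j))
        (by simpa using hi) (by simpa only [Fin.val_last, take_last] using hp)
      exact fun _ _ => rfl
    | cast i =>
      intro j hj
      induction j using Fin.lastCases with
      | last => exact absurd hj (by simp [Fin.le_def])
      | cast j =>
        simpa using h i u (fun k hk => by simpa using hu k.castSucc (by simpa using hk))
          (by simpa using hi) (by simpa only [Fin.val_castSucc, take_snoc] using hp) j
          (by simpa using hj)

theorem IsPositiveSeq.eq_of_seqLE {n : ℕ} {u v w : Fin n → W} (h : IsPositiveSeq cs v w)
    (hu : seqLE cs u v) (hp : seqProd u = seqProd v) : u = v := by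
  cases n with
  | zero => exact Subsingleton.elim _ _
  | succ n =>
    refine funext fun j => h.2 (Fin.last n) u (fun k _ => hu k)
      ((hu _).trans (h.1 _)) ?_ j (Fin.le_last j)
    rw [List.take_of_length_le (by simp), List.take_of_length_le (by simp)]
    exact hp

end Demazure

/-- **Bao–He, §3.2(b)**: for `v ≤ m_∗(w̲)` there is a unique `v̲ ∈ Wⁿ` with
`m_•(v̲) = v` which is positive in `w̲`; moreover `m_∗(v̲) = v` for this `v̲`. -/
theorem statement_18
    {B W : Type} [Group W] {M : CoxeterMatrix B}
    (cs : CoxeterSystem M W) (dem : W → W → W) (hdem : IsDemazure cs dem)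
    (n : ℕ) (w : Fin n → W) (v : W)
    (hv : BruhatLE cs v (demProd dem w)) :
    ∃ vseq : Fin n → W,
      (seqProd vseq = v ∧ IsPositiveSeq cs vseq w) ∧
      (∀ vseq' : Fin n → W, seqProd vseq' = v → IsPositiveSeq cs vseq' w →
        vseq' = vseq) ∧
      demProd dem vseq = v := by
  induction n generalizing v with
  | zero =>
    obtain ⟨u, -, rfl⟩ := hdem.bruhatLE_demProd_iff.1 hv
    exact ⟨u, ⟨rfl, fun i => i.elim0, fun i => i.elim0⟩, fun _ _ _ => Subsingleton.elim _ _,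
      by simp [demProd, seqProd]⟩
  | succ n ih =>
    induction w using Fin.snocCases with
    | snoc w y =>
    rw [hdem.demProd_snoc, hdem.bruhatLE_dem_iff] at hv
    obtain ⟨a, c, ha, hc, hac⟩ := hv
    obtain ⟨m, b, hb, hmb, hl, hmin⟩ := exists_min_left_factor (cs := cs) v y
    obtain ⟨vs, ⟨hprod, hpos⟩, huniq, hdprod⟩ := ih w m ((hmin a c hc hac).trans ha)
    refine ⟨Fin.snoc vs b, ⟨by rw [seqProd_snoc, hprod, hmb],
      isPositiveSeq_snoc_iff.2 ⟨hpos, hb, fun u z hu hz hp => ?_⟩⟩, fun vs' hprod' hpos' => ?_, ?_⟩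
    · rw [hprod, hmb] at hp
      have hle : BruhatLE cs (seqProd u) m := by
        rw [← hdprod]
        exact hdem.bruhatLE_demProd_iff.2 ⟨u, hu, rfl⟩
      have hum : seqProd u = m := hle.antisymm (hmin _ _ hz hp)
      rw [hum, ← hmb] at hp
      exact ⟨hpos.eq_of_seqLE hu (hum.trans hprod.symm), mul_left_cancel hp⟩
    · induction vs' using Fin.snocCases with
      | snoc u z =>
      rw [seqProd_snoc] at hprod'
      obtain ⟨hu, hz, hlast⟩ := isPositiveSeq_snoc_iff.1 hpos'
      have hle : BruhatLE cs m (demProd dem u) := (hmin _ _ hz hprod').trans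
        (hdem.bruhatLE_demProd_iff.2 ⟨u, fun _ => .refl _, rfl⟩)
      obtain ⟨u', hu', rfl⟩ := hdem.bruhatLE_demProd_iff.1 hle
      obtain ⟨rfl, rfl⟩ := hlast u' b hu' hb (hmb.trans hprod'.symm)
      rw [huniq u' rfl hu]
    · rw [hdem.demProd_snoc, hdprod, hdem.eq_mul, hmb]
      rw [hmb, hl]

end TotPos
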